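/- Let m ≥ 1, r > 0, and let S and S' be round spheres of radius r (spheres of radius r in (m+1)-dimensional Euclidean spaces, equipped with their intrinsic geodesic distances d and d'). Let x₀ ∈ S and let e₁,…,e_m be a basis of the tangent space T_{x₀}S with 0 < ‖e_a‖ sufficiently small (e.g. ‖e_a‖ < πr/2 for all a), and set x_a := exp_{x₀}(e_a). If x̂ ∈ S' and x̂₁,…,x̂_m ∈ S' satisfy d'(x̂, x̂_a) = d(x₀, x_a) for all a and d'(x̂_a, x̂_b) = d(x_a, x_b) for all a, b, then there exists a unique isometry f : S → S' such that f(x₀) = x̂ and f(x_a) = x̂_a for all a. -/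

import Mathlib

noncomputable section

open scoped InnerProductSpace

/-- The intrinsic (geodesic) distance between two points of the sphere of radius `r`
centered at the origin: `d(u, v) = r · arccos(⟨u, v⟩ / r²)`. -/
def sphDist {E : Type*} [NormedAddCommGroup E] [InnerProductSpace ℝ E]
    (r : ℝ) (u v : E) : ℝ :=
  r * Real.arccos (⟪u, v⟫_ℝ / r ^ 2)

/-- The Riemannian exponential map of the sphere of radius `r` (centered at the origin)
at the point `x₀`, applied to a tangent vector `e`:
`exp_{x₀}(e) = cos(‖e‖/r)·x₀ + r·sin(‖e‖/r)·e/‖e‖`. -/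
def sphExp {E : Type*} [NormedAddCommGroup E] [InnerProductSpace ℝ E]
    (r : ℝ) (x₀ e : E) : E :=
  Real.cos (‖e‖ / r) • x₀ + ((r * Real.sin (‖e‖ / r)) / ‖e‖) • e

theorem inner_div_sq_mem_Icc {E : Type*} [NormedAddCommGroup E] [InnerProductSpace ℝ E]
    {r : ℝ} {u v : E} (hu : ‖u‖ = r) (hv : ‖v‖ = r) :
    ⟪u, v⟫_ℝ / r ^ 2 ∈ Set.Icc (-1 : ℝ) 1 := by
  have := abs_le.1 (abs_real_inner_div_norm_mul_norm_le_one u v)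
  rwa [hu, hv, ← sq] at this

/-- On spheres of radius `r`, the geodesic distance determines the inner product. -/
theorem inner_eq_of_sphDist_eq {E E' : Type*} [NormedAddCommGroup E] [InnerProductSpace ℝ E]
    [NormedAddCommGroup E'] [InnerProductSpace ℝ E'] {r : ℝ} (hr : 0 < r)
    {u v : E} {u' v' : E'} (hu : ‖u‖ = r) (hv : ‖v‖ = r) (hu' : ‖u'‖ = r) (hv' : ‖v'‖ = r)
    (h : sphDist r u' v' = sphDist r u v) : ⟪u', v'⟫_ℝ = ⟪u, v⟫_ℝ := by
  have h1 := Real.arccos_injOn (inner_div_sq_mem_Icc hu' hv')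
    (inner_div_sq_mem_Icc hu hv) (mul_left_cancel₀ hr.ne' h)
  exact (div_left_inj' (by positivity)).1 h1

/-- A family with the same Gram matrix as a basis is the image of that basis under a linear
isometry. -/
theorem Module.Basis.exists_linearIsometry_of_inner_eq {ι E E' : Type*}
    [NormedAddCommGroup E] [InnerProductSpace ℝ E]
    [NormedAddCommGroup E'] [InnerProductSpace ℝ E'] (b : Module.Basis ι ℝ E) (w : ι → E')
    (h : ∀ i j, ⟪w i, w j⟫_ℝ = ⟪b i, b j⟫_ℝ) : ∃ L : E →ₗᵢ[ℝ] E', ∀ i, L (b i) = w i := by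
  have hL : ∀ y z, ⟪b.constr ℝ w y, b.constr ℝ w z⟫_ℝ = ⟪y, z⟫_ℝ := by
    have : (innerₗ E').compl₁₂ (b.constr ℝ w) (b.constr ℝ w) = innerₗ E :=
      LinearMap.ext_basis b b fun i j => by simp [h]
    exact fun y z => LinearMap.congr_fun₂ this y z
  exact ⟨(b.constr ℝ w).isometryOfInner hL, fun i => b.constr_basis ℝ w i⟩

/-- If `e` spans the orthogonal complement of `x₀`, then `x₀` together with the vectors
`c i • x₀ + s i • e i`, where `s i ≠ 0`, spans the whole space. -/
theorem span_option_elim_eq_top {ι E : Type*} [NormedAddCommGroup E] [InnerProductSpace ℝ E]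
    [FiniteDimensional ℝ E] {x₀ : E} {e : ι → E}
    (he : Submodule.span ℝ (Set.range e) = (ℝ ∙ x₀)ᗮ) {x : ι → E} {c s : ι → ℝ}
    (hs : ∀ i, s i ≠ 0) (hx : ∀ i, x i = c i • x₀ + s i • e i) :
    Submodule.span ℝ (Set.range fun o : Option ι => o.elim x₀ x) = ⊤ := by
  set S := Submodule.span ℝ (Set.range fun o : Option ι => o.elim x₀ x)
  have h₀ : x₀ ∈ S := Submodule.subset_span ⟨none, rfl⟩
  have hxS (i) : x i ∈ S := Submodule.subset_span ⟨some i, rfl⟩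
  have heS (i) : e i ∈ S := by
    rw [← S.smul_mem_iff (hs i), ← add_sub_cancel_left (c i • x₀) (s i • e i), ← hx i]
    exact S.sub_mem (hxS i) (S.smul_mem _ h₀)
  rw [eq_top_iff, ← Submodule.sup_orthogonal_of_hasOrthogonalProjection (K := ℝ ∙ x₀), ← he]
  refine sup_le ?_ (Submodule.span_le.2 (Set.range_subset_iff.2 heS))
  exact (Submodule.span_singleton_le_iff_mem _ _).2 h₀

/-- Let `S` and `S'` be round spheres of the same radius `r` in `(m+1)`-dimensional
Euclidean spaces, `x₀ ∈ S`, and `e₁, …, e_m` a basis of `T_{x₀}S` with `0 < ‖e_a‖ < πr/2`,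
`x_a := exp_{x₀}(e_a)`.  If `xh ∈ S'` and `xh₁, …, xh_m ∈ S'` satisfy
`d'(xh, xh_a) = d(x₀, x_a)` and `d'(xh_a, xh_b) = d(x_a, x_b)` for all `a, b`, then there
exists a unique isometry `f : S → S'` (distance-preserving bijection for the geodesic
distances) with `f(x₀) = xh` and `f(x_a) = xh_a` for all `a`. -/
theorem exists_unique_sphere_isometry
    (m : ℕ) (hm : 1 ≤ m) (r : ℝ) (hr : 0 < r)
    (E E' : Type) [NormedAddCommGroup E] [InnerProductSpace ℝ E]
    [NormedAddCommGroup E'] [InnerProductSpace ℝ E']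
    (hdimE : Module.finrank ℝ E = m + 1) (hdimE' : Module.finrank ℝ E' = m + 1)
    (x₀ : E) (hx₀ : ‖x₀‖ = r)
    -- a basis `e₁, …, e_m` of the tangent space `T_{x₀}S = (ℝ x₀)^⊥`, of small norms :
    (e : Fin m → E)
    (he_tangent : ∀ a : Fin m, ⟪x₀, e a⟫_ℝ = 0)
    (he_indep : LinearIndependent ℝ e)
    (he_span : Submodule.span ℝ (Set.range e) = (ℝ ∙ x₀)ᗮ)
    (he_small : ∀ a : Fin m, 0 < ‖e a‖ ∧ ‖e a‖ < Real.pi * r / 2)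
    -- the points `x_a = exp_{x₀}(e_a)` :
    (x : Fin m → E) (hx_def : ∀ a : Fin m, x a = sphExp r x₀ (e a))
    (hx_mem : ∀ a : Fin m, ‖x a‖ = r)
    -- the points `xh, xh₁, …, xh_m` of `S'` :
    (xh : E') (hxh : ‖xh‖ = r)
    (xh' : Fin m → E') (hxh' : ∀ a : Fin m, ‖xh' a‖ = r)
    -- the distance conditions :
    (hd₁ : ∀ a : Fin m, sphDist r xh (xh' a) = sphDist r x₀ (x a))
    (hd₂ : ∀ a b : Fin m, sphDist r (xh' a) (xh' b) = sphDist r (x a) (x b)) :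
    ∃! f : {u : E // ‖u‖ = r} → {u : E' // ‖u‖ = r},
      (Function.Bijective f ∧
        ∀ u v : {u : E // ‖u‖ = r}, sphDist r (f u).1 (f v).1 = sphDist r u.1 v.1) ∧
      f ⟨x₀, hx₀⟩ = ⟨xh, hxh⟩ ∧
      ∀ a : Fin m, f ⟨x a, hx_mem a⟩ = ⟨xh' a, hxh' a⟩ := by
  have : FiniteDimensional ℝ E := Module.finite_of_finrank_pos (by omega)
  have : FiniteDimensional ℝ E' := Module.finite_of_finrank_pos (by omega)
  have hspan := span_option_elim_eq_top he_span (x := x)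
    (c := fun a => Real.cos (‖e a‖ / r)) (s := fun a => r * Real.sin (‖e a‖ / r) / ‖e a‖)
    (fun a => by
      obtain ⟨h1, h2⟩ := he_small a
      have hsin : 0 < Real.sin (‖e a‖ / r) := by
        refine Real.sin_pos_of_pos_of_lt_pi (by positivity) ?_
        rw [div_lt_iff₀ hr]
        nlinarith [mul_pos Real.pi_pos hr]
      positivity) hx_def
  let b := basisOfTopLeSpanOfCardEqFinrank (fun o : Option (Fin m) => o.elim x₀ x) hspan.ge
    (by simp [hdimE])
  have hb (o) : b o = o.elim x₀ x := by simp [b]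
  have hbr (o) : ‖b o‖ = r := by cases o <;> simp [hb, hx₀, hx_mem]
  obtain ⟨L, hL⟩ := b.exists_linearIsometry_of_inner_eq (fun o => o.elim xh xh') (by
    rintro (_ | i) (_ | j)
    · simp [hb, hx₀, hxh]
    · simpa [hb] using inner_eq_of_sphDist_eq hr hx₀ (hx_mem j) hxh (hxh' j) (hd₁ j)
    · rw [real_inner_comm, real_inner_comm (b none)]
      simpa [hb] using inner_eq_of_sphDist_eq hr hx₀ (hx_mem i) hxh (hxh' i) (hd₁ i)
    · simpa [hb] using
        inner_eq_of_sphDist_eq hr (hx_mem i) (hx_mem j) (hxh' i) (hxh' j) (hd₂ i j))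
  have hL₀ : L x₀ = xh := by simpa [hb] using hL none
  have hLx (a) : L (x a) = xh' a := by simpa [hb] using hL (some a)
  have hLsurj : Function.Surjective L :=
    (L.toLinearIsometryEquiv (hdimE.trans hdimE'.symm)).surjective
  refine ⟨fun u => ⟨L u, by rw [L.norm_map, u.2]⟩, ⟨⟨⟨?_, ?_⟩, ?_⟩, ?_, ?_⟩, ?_⟩
  · exact fun u v h => Subtype.ext (L.injective (congrArg Subtype.val h))
  · rintro ⟨v, hv⟩
    obtain ⟨u, rfl⟩ := hLsurj v
    exact ⟨⟨u, by rwa [L.norm_map] at hv⟩, rfl⟩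
  · simp [sphDist]
  · exact Subtype.ext hL₀
  · exact fun a => Subtype.ext (hLx a)
  · rintro f ⟨⟨-, hf⟩, hf₀, hfx⟩
    funext u
    apply Subtype.ext
    have hfb (o) : (f ⟨b o, hbr o⟩ : E') = L (b o) := by
      cases o
      · simp [hb, hf₀, hL₀]
      · simp [hb, hfx, hLx]
    obtain ⟨w, hw⟩ := hLsurj (f u)
    have hwu : w = u := InnerProductSpace.ext_inner_right_basis b fun o => by
      have := inner_eq_of_sphDist_eq hr u.2 (hbr o) (f u).2 (f ⟨b o, hbr o⟩).2 (hf _ _)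
      rwa [hfb, ← hw, L.inner_map_map] at this
    rw [← hw, hwu]
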